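/- Let f : M → N be a quasi-isomorphism of modules over a commutative ring, i.e. an R-module homomorphism with finite kernel and finite cokernel, where M and N carry actions of an automorphism γ commuting with f. If N has finite γ-Euler characteristic (ker(γ−1) and coker(γ−1) on N are finite), then so does M, and the two Euler characteristics #ker(γ−1|M)/#coker(γ−1|M) and #ker(γ−1|N)/#coker(γ−1|N) are equal. -/

import Mathlib

namespace AddMonoidHom

variable {A B C : Type*} [AddCommGroup A] [AddCommGroup B] [AddCommGroup C]

theorem card_ker_comp (g : B →+ C) (f : A →+ B) :
    Nat.card (g.comp f).ker = Nat.card f.ker * Nat.card (g.ker ⊓ f.range : AddSubgroup B) := by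
  let φ : (g.comp f).ker →+ B := f.comp (g.comp f).ker.subtype
  have hrange : φ.range = g.ker ⊓ f.range := by
    ext y
    constructor
    · rintro ⟨x, rfl⟩
      exact ⟨x.2, x.1, rfl⟩
    · rintro ⟨hy, x, rfl⟩
      exact ⟨⟨x, hy⟩, rfl⟩
  have hker : Nat.card φ.ker = Nat.card f.ker :=
    Nat.card_congr
      { toFun := fun x => ⟨x.1.1, x.2⟩
        invFun := fun x => ⟨⟨x.1, by
          rw [mem_ker, comp_apply, mem_ker.mp x.2, map_zero]⟩, x.2⟩
        left_inv := fun _ => rfl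
        right_inv := fun _ => rfl }
  rw [← φ.ker.card_mul_index, AddSubgroup.index_ker, hrange, hker]

theorem index_range_comp (g : B →+ C) (f : A →+ B) :
    (g.comp f).range.index = (f.range ⊔ g.ker).index * g.range.index := by
  rw [range_comp, AddSubgroup.index_map]

theorem index_range_eq_relIndex_ker_mul (g : B →+ C) (f : A →+ B) :
    f.range.index = f.range.relIndex g.ker * (f.range ⊔ g.ker).index := by
  rw [← AddSubgroup.relIndex_sup_left, AddSubgroup.relIndex_mul_index le_sup_left]

theorem card_ker_eq_card_inf_range_mul (g : B →+ C) (f : A →+ B) :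
    Nat.card g.ker =
      Nat.card (g.ker ⊓ f.range : AddSubgroup B) * f.range.relIndex g.ker := by
  rw [← AddSubgroup.inf_relIndex_left, ← AddSubgroup.relIndex_bot_left,
    ← AddSubgroup.relIndex_bot_left,
    AddSubgroup.relIndex_mul_relIndex _ _ _ bot_le inf_le_left]

theorem card_ker_comp_mul_index_range (g : B →+ C) (f : A →+ B) :
    Nat.card (g.comp f).ker * (f.range.index * g.range.index) =
      Nat.card f.ker * Nat.card g.ker * (g.comp f).range.index := by
  rw [card_ker_comp, index_range_comp, index_range_eq_relIndex_ker_mul g f,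
    card_ker_eq_card_inf_range_mul g f]
  ring

theorem card_ker_comp_ne_zero {g : B →+ C} {f : A →+ B}
    (hf : Nat.card f.ker ≠ 0) (hg : Nat.card g.ker ≠ 0) : Nat.card (g.comp f).ker ≠ 0 := by
  rw [card_ker_comp]
  rw [card_ker_eq_card_inf_range_mul g f] at hg
  exact mul_ne_zero hf (left_ne_zero_of_mul hg)

theorem index_range_comp_ne_zero {g : B →+ C} {f : A →+ B}
    (hf : f.range.index ≠ 0) (hg : g.range.index ≠ 0) : (g.comp f).range.index ≠ 0 := by
  rw [index_range_comp]
  rw [index_range_eq_relIndex_ker_mul g f] at hf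
  exact mul_ne_zero (right_ne_zero_of_mul hf) hg

theorem card_ker_ne_zero_of_comp {g : B →+ C} {f : A →+ B}
    (h : Nat.card (g.comp f).ker ≠ 0) : Nat.card f.ker ≠ 0 := by
  rw [card_ker_comp] at h
  exact left_ne_zero_of_mul h

theorem index_range_ne_zero_of_comp {g : B →+ C} {f : A →+ B}
    (h : (g.comp f).range.index ≠ 0) (hg : Nat.card g.ker ≠ 0) : f.range.index ≠ 0 := by
  rw [index_range_comp] at h
  rw [card_ker_eq_card_inf_range_mul g f] at hg
  rw [index_range_eq_relIndex_ker_mul g f]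
  exact mul_ne_zero (right_ne_zero_of_mul hg) (left_ne_zero_of_mul h)

end AddMonoidHom


/-- Quasi-isomorphisms preserve `γ`-Euler characteristics: if `f : M → N` has finite kernel
and cokernel and intertwines automorphisms `γ_M`, `γ_N`, and if `ker(γ_N − 1)` and
`coker(γ_N − 1)` are finite, then `ker(γ_M − 1)` and `coker(γ_M − 1)` are finite and
`#ker(γ_M−1)/#coker(γ_M−1) = #ker(γ_N−1)/#coker(γ_N−1)`. -/
theorem eulerChar_eq_of_quasiIso {M N : Type*} [AddCommGroup M] [AddCommGroup N]
    (γM : M ≃+ M) (γN : N ≃+ N) (f : M →+ N)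
    (hcomm : ∀ m : M, f (γM m) = γN (f m))
    (hker : Finite f.ker) (hcoker : Finite (N ⧸ f.range))
    (hkerN : Finite (γN.toAddMonoidHom - AddMonoidHom.id N).ker)
    (hcokerN : Finite (N ⧸ (γN.toAddMonoidHom - AddMonoidHom.id N).range)) :
    Finite (γM.toAddMonoidHom - AddMonoidHom.id M).ker ∧
    Finite (M ⧸ (γM.toAddMonoidHom - AddMonoidHom.id M).range) ∧
    Nat.card (γM.toAddMonoidHom - AddMonoidHom.id M).ker *
        Nat.card (N ⧸ (γN.toAddMonoidHom - AddMonoidHom.id N).range) =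
      Nat.card (γN.toAddMonoidHom - AddMonoidHom.id N).ker *
        Nat.card (M ⧸ (γM.toAddMonoidHom - AddMonoidHom.id M).range) := by
  set a := γM.toAddMonoidHom - AddMonoidHom.id M
  set b := γN.toAddMonoidHom - AddMonoidHom.id N
  have hab : f.comp a = b.comp f := by
    ext m
    simp [a, b, hcomm]
  have kf : Nat.card f.ker ≠ 0 := Nat.card_pos.ne'
  have cf : f.range.index ≠ 0 := (Nat.card_pos (α := N ⧸ f.range)).ne'
  have kb : Nat.card b.ker ≠ 0 := Nat.card_pos.ne'
  have cb : b.range.index ≠ 0 := (Nat.card_pos (α := N ⧸ b.range)).ne'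
  have kc : Nat.card (f.comp a).ker ≠ 0 := hab ▸ AddMonoidHom.card_ker_comp_ne_zero kf kb
  have cc : (f.comp a).range.index ≠ 0 := hab ▸ AddMonoidHom.index_range_comp_ne_zero cf cb
  have ka := AddMonoidHom.card_ker_ne_zero_of_comp kc
  have ca := AddMonoidHom.index_range_ne_zero_of_comp cc kf
  refine ⟨Nat.finite_of_card_ne_zero ka, Nat.finite_of_card_ne_zero ca, ?_⟩
  change Nat.card a.ker * b.range.index = Nat.card b.ker * a.range.index
  have e₁ := AddMonoidHom.card_ker_comp_mul_index_range f a
  have e₂ := AddMonoidHom.card_ker_comp_mul_index_range b f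
  rw [← hab] at e₂
  refine mul_left_cancel₀ (mul_ne_zero (mul_ne_zero kf cf) (mul_ne_zero kc cc)) ?_
  calc
    _ = (Nat.card a.ker * Nat.card f.ker * (f.comp a).range.index) *
        (Nat.card (f.comp a).ker * (f.range.index * b.range.index)) := by ring
    _ = _ := by rw [← e₁, e₂]; ring
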